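/- (Propagation of a magnified function.) Let λ > 0 with k = 2π/λ, let m̃ > 0 and ζ ≠ 0 be real, and let ψ : ℝ² → ℂ be integrable. Then for every x ∈ ℝ²: 𝒫_{ζ}(ℳ_{m̃} ψ)(x) = e^{ikζ(1 − 1/m̃²)} · 𝒫_{ζ/m̃²}(ψ)(x/m̃), where ℳ_{m̃} ψ(x) = ψ(x/m̃). Equivalently, 𝒫_ζ ∘ ℳ_{m̃} = e^{ikζ(1−1/m̃²)} · ℳ_{m̃} ∘ 𝒫_{ζ/m̃²} on integrable functions. -/

import Mathlib

open MeasureTheory Real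

noncomputable section

/-- The plane ℝ² with the Euclidean norm. -/
abbrev Plane := EuclideanSpace ℝ (Fin 2)

/-- The Fresnel kernel `P_Z(x) = (e^{ikZ}/(iλZ)) exp(iπ‖x‖²/(λZ))` with `k = 2π/λ`. -/
def fresnelKernel (lam Z : ℝ) (x : Plane) : ℂ :=
  (Complex.exp ((2 * π / lam * Z : ℝ) * Complex.I) / (Complex.I * (lam : ℂ) * (Z : ℂ))) *
    Complex.exp ((π * ‖x‖ ^ 2 / (lam * Z) : ℝ) * Complex.I)

/-- The Fresnel propagator: convolution with the Fresnel kernel. -/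
def fresnelProp (lam Z : ℝ) (ψ : Plane → ℂ) (x : Plane) : ℂ :=
  ∫ w, ψ w * fresnelKernel lam Z (x - w)

/-- The magnification (dilation) operator `ℳ_m ψ(x) = ψ(x/m)`. -/
def mag (m : ℝ) (ψ : Plane → ℂ) (x : Plane) : ℂ := ψ ((1 / m) • x)

/-- Scaling of the Fresnel kernel under dilation of its argument. -/
lemma fresnelKernel_smul (lam Z m : ℝ) (hm : m ≠ 0) (x : Plane) :
    (m : ℂ) ^ 2 * fresnelKernel lam Z (m • x) =
      Complex.exp ((2 * π / lam * Z * (1 - 1 / m ^ 2) : ℝ) * Complex.I) *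
        fresnelKernel lam (Z / m ^ 2) x := by
  have hm' : (m : ℂ) ≠ 0 := Complex.ofReal_ne_zero.2 hm
  have hphase : Complex.exp ((2 * π / lam * Z : ℝ) * Complex.I) =
      Complex.exp ((2 * π / lam * Z * (1 - 1 / m ^ 2) : ℝ) * Complex.I) *
        Complex.exp ((2 * π / lam * (Z / m ^ 2) : ℝ) * Complex.I) := by
    rw [← Complex.exp_add, ← add_mul, ← Complex.ofReal_add]
    congr 3
    ring
  have hquad : π * ‖m • x‖ ^ 2 / (lam * Z) = π * ‖x‖ ^ 2 / (lam * (Z / m ^ 2)) := by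
    rw [norm_smul, mul_pow, Real.norm_eq_abs, sq_abs, ← mul_div_assoc, div_div_eq_mul_div]
    ring
  have hamp : Complex.I * (lam : ℂ) * ((Z / m ^ 2 : ℝ) : ℂ) =
      Complex.I * lam * Z / (m : ℂ) ^ 2 := by
    push_cast
    ring
  rw [fresnelKernel, fresnelKernel, hphase, hquad, hamp, div_div_eq_mul_div]
  ring

/-- Propagation of a magnified function:
`𝒫_ζ(ℳ_m̃ ψ)(x) = e^{ikζ(1-1/m̃²)} 𝒫_{ζ/m̃²}(ψ)(x/m̃)`. -/
theorem fresnel_of_mag (lam k mt ζ : ℝ) (hlam : 0 < lam) (hk : k = 2 * π / lam)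
    (hmt : 0 < mt) (hζ : ζ ≠ 0) (ψ : Plane → ℂ) (hψ : Integrable ψ) (x : Plane) :
    fresnelProp lam ζ (mag mt ψ) x =
      Complex.exp ((k * ζ * (1 - 1 / mt ^ 2) : ℝ) * Complex.I) *
        fresnelProp lam (ζ / mt ^ 2) ψ ((1 / mt) • x) := by
  let f : Plane → ℂ := fun v => ψ v * fresnelKernel lam ζ (mt • ((1 / mt) • x - v))
  have hpoint : ∀ w : Plane, mag mt ψ w * fresnelKernel lam ζ (x - w) = f (mt⁻¹ • w) := by
    intro w
    simp only [f, mag, one_div, smul_sub, smul_inv_smul₀ hmt.ne']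
  rw [fresnelProp, fresnelProp, integral_congr_ae (.of_forall hpoint),
    Measure.integral_comp_inv_smul_of_nonneg volume f hmt.le, finrank_euclideanSpace_fin,
    Complex.real_smul, ← integral_const_mul, ← integral_const_mul]
  congr 1 with v
  rw [hk, mul_left_comm, Complex.ofReal_pow, fresnelKernel_smul lam ζ mt hmt.ne', mul_left_comm]
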